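/- arXiv:2309.02132 — 3 statements merged into one kernel-verified Lean document; each statement's English description precedes it below -/
import Mathlib

section
/- Promising graph, type 1: Suppose that in a play of the (K^{ℵ0}, K^4)-building game it is the first player's turn, and there are five distinct vertices a, b, c, d, e such that the edges ab, ac, ad, ae, bc, cd are red, the edge bd is blue, and all other edges among {a, b, c, d, e} are unclaimed. Suppose further that on the whole board the blue edges contain no K^4 and admit no blue threat (no 4-element vertex set with five blue edges and the sixth edge unclaimed). Then the first player has a winning strategy from this position; in fact, by claiming ce she creates two red threats at once (on {a, c, d, e} missing de and on {a, b, c, e} missing be) and completes a red K^4 within at most 2 further moves of hers. -/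
/-!
Positions in the `(K^{ℵ₀}, K^4)`-building game.  A position is a pair `(R, B)`
of disjoint finite sets of red (first player's) and blue (second player's)
edges of the complete graph on `ℕ`; an edge is unclaimed if it lies in neither
set.
-/

/-- A history of further moves played from a position, in chronological order;
the player to move plays at even indices, the other player at odd indices. -/
abbrev Hist : Type := List (Sym2 ℕ)

/-- A strategy: assigns to each sequence of previously claimed edges an edge. -/
abbrev Strategy : Type := Hist → Sym2 ℕ

/-- The edges claimed at even indices of a history. -/
def firstPlayerEdges (h : Hist) : Set (Sym2 ℕ) :=
  {x | ∃ i : Fin h.length, (i : ℕ) % 2 = 0 ∧ h.get i = x}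

/-- The edges claimed at odd indices of a history. -/
def secondPlayerEdges (h : Hist) : Set (Sym2 ℕ) :=
  {x | ∃ i : Fin h.length, (i : ℕ) % 2 = 1 ∧ h.get i = x}

/-- The red edges after the further moves `h` have been played from a position
with red edges `R`, the first player (red) moving at even indices. -/
def redAfter (R : Finset (Sym2 ℕ)) (h : Hist) : Set (Sym2 ℕ) :=
  ↑R ∪ firstPlayerEdges h

/-- The blue edges after the further moves `h` have been played from a
position with blue edges `B`, the second player (blue) moving at odd
indices. -/
def blueAfter (B : Finset (Sym2 ℕ)) (h : Hist) : Set (Sym2 ℕ) :=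
  ↑B ∪ secondPlayerEdges h

/-- An edge is a legal move if it is a proper edge (not a loop) and is
unclaimed, i.e. lies neither in the position `(R, B)` nor in the history `h`
of further moves. -/
def LegalFrom (R B : Finset (Sym2 ℕ)) (h : Hist) (x : Sym2 ℕ) : Prop :=
  ¬ x.IsDiag ∧ x ∉ R ∧ x ∉ B ∧ x ∉ h

/-- The history of further moves after `n` moves, when the player to move
follows the strategy `σ` and the other player follows the strategy `τ`. -/
def play (σ τ : Strategy) : ℕ → Hist
  | 0 => []
  | n + 1 => play σ τ n ++ [if n % 2 = 0 then σ (play σ τ n) else τ (play σ τ n)]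

/-- `E` contains all six edges on some 4-element vertex set. -/
def HasK4 (E : Set (Sym2 ℕ)) : Prop :=
  ∃ t : Finset ℕ, t.card = 4 ∧ ∀ u ∈ t, ∀ v ∈ t, u ≠ v → s(u, v) ∈ E

/-- A threat for the colour with edge set `C`, the other colour having edge
set `O`: a 4-element vertex set `t` on which the edge `x` is unclaimed while
all five other edges belong to `C`. -/
def IsThreat (C O : Set (Sym2 ℕ)) (t : Finset ℕ) (x : Sym2 ℕ) : Prop :=
  t.card = 4 ∧ (∃ u ∈ t, ∃ v ∈ t, u ≠ v ∧ x = s(u, v)) ∧ x ∉ C ∧ x ∉ O ∧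
    ∀ u ∈ t, ∀ v ∈ t, u ≠ v → s(u, v) ≠ x → s(u, v) ∈ C

/-- The colour with edge set `C` admits a threat (the other colour having edge
set `O`). -/
def HasThreat (C O : Set (Sym2 ℕ)) : Prop := ∃ t x, IsThreat C O t x

/-- From the position `(R, B)` with the first player (red) to move, the first
player has a winning strategy which completes a red `K^4` within at most
`(bound + 1) / 2` further moves of hers: against every legally playing
opponent there is an odd stage `n ≤ bound` (i.e. a stage just after one of her
own moves, her `r`-th further move being move number `2 * r - 1`) at which,
all of her moves having been legal, the red edges contain a `K^4` while the
blue edges do not. -/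
def WinsFromWithin (R B : Finset (Sym2 ℕ)) (bound : ℕ) : Prop :=
  ∃ σ : Strategy, ∀ τ : Strategy,
    (∀ n, n % 2 = 1 → (∃ x, LegalFrom R B (play σ τ n) x) →
      LegalFrom R B (play σ τ n) (τ (play σ τ n))) →
    ∃ n ≤ bound, n % 2 = 1 ∧
      (∀ m < n, m % 2 = 0 → LegalFrom R B (play σ τ m) (σ (play σ τ m))) ∧
      HasK4 (redAfter R (play σ τ n)) ∧ ¬ HasK4 (blueAfter B (play σ τ n))

/-- Adding an unclaimed edge to a colour with neither a `K^4` nor a threat creates no `K^4`. -/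
theorem not_hasK4_insert_of_not_hasThreat {C O : Set (Sym2 ℕ)} {x : Sym2 ℕ}
    (hK4 : ¬ HasK4 C) (hthreat : ¬ HasThreat C O) (hxO : x ∉ O) :
    ¬ HasK4 (insert x C) := by
  rintro ⟨t, ht, h⟩
  by_cases hx : x ∈ C
  · exact hK4 ⟨t, ht, by rwa [Set.insert_eq_of_mem hx] at h⟩
  by_cases hxt : ∃ u ∈ t, ∃ v ∈ t, u ≠ v ∧ x = s(u, v)
  · exact hthreat ⟨t, x, ht, hxt, hx, hxO, fun u hu v hv huv hne =>
      (h u hu v hv huv).resolve_left hne⟩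
  · exact hK4 ⟨t, ht, fun u hu v hv huv =>
      (h u hu v hv huv).resolve_left fun hux => hxt ⟨u, hu, v, hv, huv, hux.symm⟩⟩

/-- Claiming the missing edge of a threat completes a `K^4`. -/
theorem IsThreat.hasK4_of_subset {C O E : Set (Sym2 ℕ)} {t : Finset ℕ} {x : Sym2 ℕ}
    (h : IsThreat C O t x) (hC : C ⊆ E) (hx : x ∈ E) : HasK4 E := by
  obtain ⟨ht, -, -, -, h⟩ := h
  refine ⟨t, ht, fun u hu v hv huv => ?_⟩
  by_cases hux : s(u, v) = x
  · exact hux ▸ hx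
  · exact hC (h u hu v hv huv hux)

/-- Four distinct vertices carrying five edges of a colour and one unclaimed edge form a threat. -/
theorem isThreat_of_five_edges {C O : Set (Sym2 ℕ)} {p q r s : ℕ}
    (hcard : ({p, q, r, s} : Finset ℕ).card = 4)
    (hpq : s(p, q) ∈ C) (hpr : s(p, r) ∈ C) (hps : s(p, s) ∈ C)
    (hqr : s(q, r) ∈ C) (hqs : s(q, s) ∈ C) (hrs : r ≠ s)
    (hC : s(r, s) ∉ C) (hO : s(r, s) ∉ O) :
    IsThreat C O {p, q, r, s} s(r, s) := by
  refine ⟨hcard, ⟨r, by simp, s, by simp, hrs, rfl⟩, hC, hO, ?_⟩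
  intro u hu v hv huv hne
  simp only [Finset.mem_insert, Finset.mem_singleton] at hu hv
  rcases hu with rfl | rfl | rfl | rfl <;> rcases hv with rfl | rfl | rfl | rfl <;>
    first
    | exact absurd rfl huv
    | exact absurd rfl hne
    | exact absurd Sym2.eq_swap hne
    | assumption
    | (rw [Sym2.eq_swap]; assumption)

theorem firstPlayerEdges_three (x y z : Sym2 ℕ) : firstPlayerEdges [x, y, z] = {x, z} := by
  ext w
  simp [firstPlayerEdges, Fin.exists_fin_succ, eq_comm]

theorem secondPlayerEdges_three (x y z : Sym2 ℕ) : secondPlayerEdges [x, y, z] = {y} := by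
  ext w
  simp [secondPlayerEdges, Fin.exists_fin_succ, eq_comm]

/-- If claiming `x` creates two red threats with distinct missing edges `y` and `z` while blue has
neither a `K^4` nor a threat, then the first player wins within two moves by claiming `x`. -/
theorem winsFromWithin_three_of_double_threat {R B : Finset (Sym2 ℕ)} {x y z : Sym2 ℕ}
    {t t' : Finset ℕ} (hx : LegalFrom R B [] x) (hyz : y ≠ z)
    (hy : IsThreat (↑R ∪ {x}) ↑B t y) (hz : IsThreat (↑R ∪ {x}) ↑B t' z)
    (hK4 : ¬ HasK4 ↑B) (hthreat : ¬ HasThreat ↑B ↑R) :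
    WinsFromWithin R B 3 := by
  have legal : ∀ {s w}, IsThreat (↑R ∪ {x}) ↑B s w → ¬ w.IsDiag ∧ w ∉ R ∧ w ∉ B ∧ w ≠ x := by
    rintro s w ⟨-, ⟨u, -, v, -, huv, rfl⟩, hwC, hwB, -⟩
    simp only [Set.mem_union, Finset.mem_coe, Set.mem_singleton_iff, not_or] at hwC
    exact ⟨by simpa using huv, hwC.1, by simpa using hwB, hwC.2⟩
  let σ : Strategy := fun h => if h = [] then x else if y ∈ h then z else y
  refine ⟨σ, fun τ hτ => ⟨3, le_rfl, rfl, ?_⟩⟩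
  obtain ⟨hyd, hyR, hyB, hyx⟩ := legal hy
  obtain ⟨hzd, hzR, hzB, hzx⟩ := legal hz
  have play_one : play σ τ 1 = [x] := by simp [play, σ]
  have reply_legal := hτ 1 rfl ⟨y, by rw [play_one]; exact ⟨hyd, hyR, hyB, by simpa using hyx⟩⟩
  rw [play_one] at reply_legal
  set w := τ [x] with hw
  have play_two : play σ τ 2 = [x, w] := by
    rw [play, play_one]; simp [hw]
  obtain ⟨v, s, hv, hs, hvw⟩ : ∃ v s, σ [x, w] = v ∧ IsThreat (↑R ∪ {x}) ↑B s v ∧ v ≠ w := by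
    by_cases hyw : y = w
    · exact ⟨z, t', by simp [σ, hyw], hz, hyw ▸ hyz.symm⟩
    · exact ⟨y, t, by simp [σ, hyw, hyx], hy, hyw⟩
  have play_three : play σ τ 3 = [x, w, v] := by
    rw [play, play_two]; simp [hv]
  obtain ⟨hvd, hvR, hvB, hvx⟩ := legal hs
  refine ⟨fun m hm heven => ?_, ?_, ?_⟩
  · obtain rfl | rfl : m = 0 ∨ m = 2 := by omega
    · simpa [play, σ] using hx
    · rw [play_two, hv]
      exact ⟨hvd, hvR, hvB, by simp [hvx, hvw]⟩
  · rw [play_three, redAfter, firstPlayerEdges_three]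
    exact hs.hasK4_of_subset (Set.union_subset_union_right _ (by simp)) (by simp)
  · rw [play_three, blueAfter, secondPlayerEdges_three, Set.union_singleton]
    exact not_hasK4_insert_of_not_hasThreat hK4 hthreat (by simpa using reply_legal.2.1)

/-- Promising graph of type 1.  Suppose that in a play of the
`(K^{ℵ₀}, K^4)`-building game it is the first player's turn and there are five
distinct vertices `a, b, c, d, e` such that the edges `ab, ac, ad, ae, bc, cd`
are red, the edge `bd` is blue, and all other edges among `{a, b, c, d, e}`
(namely `be, ce, de`) are unclaimed.  Suppose further that on the whole board
the blue edges contain no `K^4` and admit no blue threat.  Then the first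
player has a winning strategy from this position; in fact, by claiming `ce`
she creates two red threats at once (on `{a, c, d, e}` missing `de` and on
`{a, b, c, e}` missing `be`) and completes a red `K^4` within at most 2
further moves of hers. -/
theorem promising_graph_type_one
    (R B : Finset (Sym2 ℕ)) (hdisj : Disjoint R B)
    (a b c d e : ℕ)
    (hdist : ({a, b, c, d, e} : Finset ℕ).card = 5)
    (hab : s(a, b) ∈ R) (hac : s(a, c) ∈ R) (had : s(a, d) ∈ R)
    (hae : s(a, e) ∈ R) (hbc : s(b, c) ∈ R) (hcd : s(c, d) ∈ R)
    (hbd : s(b, d) ∈ B)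
    (hbe : s(b, e) ∉ R ∧ s(b, e) ∉ B)
    (hce : s(c, e) ∉ R ∧ s(c, e) ∉ B)
    (hde : s(d, e) ∉ R ∧ s(d, e) ∉ B)
    (hnoblueK4 : ¬ HasK4 ↑B)
    (hnobluethreat : ¬ HasThreat ↑B ↑R) :
    (IsThreat (↑R ∪ {s(c, e)}) ↑B {a, c, d, e} s(d, e) ∧
      IsThreat (↑R ∪ {s(c, e)}) ↑B {a, b, c, e} s(b, e)) ∧
    WinsFromWithin R B 3 := by
  have hnodup : [a, b, c, d, e].Nodup := by
    rw [← Multiset.coe_nodup, ← Multiset.toFinset_card_eq_card_iff_nodup]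
    simpa using hdist
  simp only [List.nodup_cons, List.mem_cons, List.not_mem_nil, or_false, not_or,
    List.nodup_nil, not_false_eq_true, and_true] at hnodup
  obtain ⟨⟨nab, nac, nad, nae⟩, ⟨nbc, nbd, nbe⟩, ⟨ncd, nce⟩, nde⟩ := hnodup
  have threat_de : IsThreat (↑R ∪ {s(c, e)}) ↑B {a, c, d, e} s(d, e) := by
    apply isThreat_of_five_edges <;> simp_all [Ne.symm]
  have threat_be : IsThreat (↑R ∪ {s(c, e)}) ↑B {a, c, b, e} s(b, e) := by
    apply isThreat_of_five_edges <;> simp_all [Sym2.eq_swap, Ne.symm]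
  rw [Finset.insert_comm c b] at threat_be
  exact ⟨⟨threat_de, threat_be⟩, winsFromWithin_three_of_double_threat
    ⟨by simpa using nce, hce.1, hce.2, by simp⟩ (by simp_all [Ne.symm]) threat_de threat_be
    hnoblueK4 hnobluethreat⟩
end

section
/- Promising graph, type 2: Suppose that in a play of the (K^{ℵ0}, K^4)-building game it is the first player's turn, and there are five distinct vertices a, b, c, d, e such that the edges ab, ac, ad, ae, bc are red and all other edges among {a, b, c, d, e} are unclaimed (in particular the vulnerable edge bd is unclaimed). Suppose further that on the whole board, even after adding bd as a blue edge, the blue edges contain no K^4 and admit no blue threat. Then the first player has a winning strategy from this position: each of her moves before the last creates a red threat, and she completes a red K^4 within at most 3 further moves of hers (she claims cd, and if the second player answers bd she then claims ce, creating two red threats at once). -/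
/-- From the position `(R, B)` with the first player (red) to move, the first
player has a winning strategy which completes a red `K^4` within at most
`(bound + 1) / 2` further moves of hers, each of her moves before the last
creating a red threat: against every legally playing opponent there is an odd
stage `n ≤ bound` (a stage just after one of her own moves, her `r`-th further
move being move number `2 * r - 1`) at which, all of her moves having been
legal and each of her moves before the last having created a red threat, the
red edges contain a `K^4` while the blue edges do not. -/
def WinsFromWithinThreats (R B : Finset (Sym2 ℕ)) (bound : ℕ) : Prop :=
  ∃ σ : Strategy, ∀ τ : Strategy,
    (∀ n, n % 2 = 1 → (∃ x, LegalFrom R B (play σ τ n) x) →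
      LegalFrom R B (play σ τ n) (τ (play σ τ n))) →
    ∃ n ≤ bound, n % 2 = 1 ∧
      (∀ m < n, m % 2 = 0 → LegalFrom R B (play σ τ m) (σ (play σ τ m))) ∧
      (∀ m, m % 2 = 0 → m + 1 < n →
        HasThreat (redAfter R (play σ τ (m + 1)))
          (blueAfter B (play σ τ (m + 1)))) ∧
      HasK4 (redAfter R (play σ τ n)) ∧ ¬ HasK4 (blueAfter B (play σ τ n))

theorem firstPlayerEdges_nil : firstPlayerEdges [] = ∅ := by
  ext x
  simp [firstPlayerEdges]

theorem secondPlayerEdges_nil : secondPlayerEdges [] = ∅ := by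
  ext x
  simp [secondPlayerEdges]

theorem firstPlayerEdges_cons (y : Sym2 ℕ) (h : Hist) :
    firstPlayerEdges (y :: h) = insert y (secondPlayerEdges h) := by
  ext x
  simp only [firstPlayerEdges, secondPlayerEdges, Set.mem_ofPred_eq, Set.mem_insert_iff,
    List.length_cons, Fin.exists_fin_succ, List.get_cons_zero, List.get_cons_succ',
    Fin.val_zero, Fin.val_succ, Nat.zero_mod, true_and]
  refine or_congr eq_comm (exists_congr fun i => and_congr_left fun _ => ?_)
  omega

theorem secondPlayerEdges_cons (y : Sym2 ℕ) (h : Hist) :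
    secondPlayerEdges (y :: h) = firstPlayerEdges h := by
  ext x
  simp only [firstPlayerEdges, secondPlayerEdges, Set.mem_ofPred_eq,
    List.length_cons, Fin.exists_fin_succ, List.get_cons_zero, List.get_cons_succ',
    Fin.val_zero, Fin.val_succ, Nat.zero_mod, zero_ne_one, false_and, false_or]
  refine exists_congr fun i => and_congr_left fun _ => ?_
  omega

/-- Claiming one further unclaimed edge cannot complete a `K^4` for a colour without threats. -/
theorem not_hasK4_insert_of_not_hasThreat_s6 {C O : Set (Sym2 ℕ)} {y : Sym2 ℕ}
    (hK : ¬ HasK4 C) (hT : ¬ HasThreat C O) (hyC : y ∉ C) (hyO : y ∉ O) :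
    ¬ HasK4 (insert y C) := by
  rintro ⟨t, ht, hall⟩
  by_cases hy : ∃ u ∈ t, ∃ v ∈ t, u ≠ v ∧ y = s(u, v)
  · exact hT ⟨t, y, ht, hy, hyC, hyO, fun u hu v hv huv hne =>
      (hall u hu v hv huv).resolve_left hne⟩
  · exact hK ⟨t, ht, fun u hu v hv huv =>
      (hall u hu v hv huv).resolve_left fun h => hy ⟨u, hu, v, hv, huv, h.symm⟩⟩

theorem HasK4.mono {E F : Set (Sym2 ℕ)} (hEF : E ⊆ F) (hE : HasK4 E) : HasK4 F := by
  obtain ⟨t, ht, hall⟩ := hE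
  exact ⟨t, ht, fun u hu v hv huv => hEF (hall u hu v hv huv)⟩

/-- Four vertices spanning five edges of `C` and an unclaimed sixth edge `zw` form a threat. -/
theorem isThreat_of_five_edges_s6 {C O : Set (Sym2 ℕ)} {x y z w : ℕ}
    (hcard : ({x, y, z, w} : Finset ℕ).card = 4)
    (hxy : s(x, y) ∈ C) (hxz : s(x, z) ∈ C) (hxw : s(x, w) ∈ C) (hyz : s(y, z) ∈ C)
    (hyw : s(y, w) ∈ C) (hzwC : s(z, w) ∉ C) (hzwO : s(z, w) ∉ O) :
    IsThreat C O {x, y, z, w} s(z, w) := by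
  have hzw : z ≠ w := by
    rintro rfl
    have := Finset.card_le_three (a := x) (b := y) (c := z)
    simp only [Finset.pair_eq_singleton] at hcard
    omega
  refine ⟨hcard, ⟨z, by simp, w, by simp, hzw, rfl⟩, hzwC, hzwO, ?_⟩
  intro u hu v hv huv hne
  simp only [Finset.mem_insert, Finset.mem_singleton] at hu hv
  rcases hu with rfl | rfl | rfl | rfl <;> rcases hv with rfl | rfl | rfl | rfl <;>
    first
    | assumption
    | exact absurd rfl huv
    | exact absurd rfl hne
    | exact absurd Sym2.eq_swap hne
    | (rw [Sym2.eq_swap]; assumption)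

/-- Claiming the missing edge of a threat completes a `K^4`. -/
theorem IsThreat.hasK4_insert {C O : Set (Sym2 ℕ)} {t : Finset ℕ} {x : Sym2 ℕ}
    (h : IsThreat C O t x) : HasK4 (insert x C) :=
  ⟨t, h.1, fun u hu v hv huv => or_iff_not_imp_left.2 (h.2.2.2.2 u hu v hv huv)⟩

/-- The first player's strategy: claim `cd`; then complete `abcd` by `bd` if possible, and
otherwise claim `ce` and complete `abce` by `be` or `acde` by `de`. -/
def promisingStrategy (b c d e : ℕ) : Strategy
  | [] => s(c, d)
  | [_, y] => if y = s(b, d) then s(c, e) else s(b, d)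
  | [_, _, _, z] => if z = s(b, e) then s(d, e) else s(b, e)
  | _ => s(c, d)

/-- Promising graph of type 2.  Suppose that in a play of the
`(K^{ℵ₀}, K^4)`-building game it is the first player's turn and there are five
distinct vertices `a, b, c, d, e` such that the edges `ab, ac, ad, ae, bc` are
red and all other edges among `{a, b, c, d, e}` (namely `bd, be, cd, ce, de`,
in particular the vulnerable edge `bd`) are unclaimed.  Suppose further that
on the whole board, even after adding `bd` as a blue edge, the blue edges
contain no `K^4` and admit no blue threat.  Then the first player has a
winning strategy from this position: each of her moves before the last creates
a red threat, and she completes a red `K^4` within at most 3 further moves of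
hers. -/
theorem promising_graph_type_two
    (R B : Finset (Sym2 ℕ)) (hdisj : Disjoint R B)
    (a b c d e : ℕ)
    (hdist : ({a, b, c, d, e} : Finset ℕ).card = 5)
    (hab : s(a, b) ∈ R) (hac : s(a, c) ∈ R) (had : s(a, d) ∈ R)
    (hae : s(a, e) ∈ R) (hbc : s(b, c) ∈ R)
    (hbd : s(b, d) ∉ R ∧ s(b, d) ∉ B)
    (hbe : s(b, e) ∉ R ∧ s(b, e) ∉ B)
    (hcd : s(c, d) ∉ R ∧ s(c, d) ∉ B)
    (hce : s(c, e) ∉ R ∧ s(c, e) ∉ B)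
    (hde : s(d, e) ∉ R ∧ s(d, e) ∉ B)
    (hnoblueK4 : ¬ HasK4 (↑B ∪ {s(b, d)}))
    (hnobluethreat : ¬ HasThreat (↑B ∪ {s(b, d)}) ↑R) :
    WinsFromWithinThreats R B 5 := by
  have hnodup : [a, b, c, d, e].Nodup := by
    rw [← List.dedup_eq_self, ← (List.dedup_sublist _).length_eq, ← List.card_toFinset]
    simpa using hdist
  simp only [List.nodup_cons, List.mem_cons, List.not_mem_nil, or_false, not_or] at hnodup
  obtain ⟨⟨hnab, hnac, hnad, hnae⟩, ⟨hnbc, hnbd, hnbe⟩, ⟨hncd, hnce⟩, hnde, -⟩ := hnodup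
  refine ⟨promisingStrategy b c d e, fun τ hτ => ?_⟩
  obtain ⟨y, hy⟩ : ∃ y, y = τ [s(c, d)] := ⟨_, rfl⟩
  have p1 : play (promisingStrategy b c d e) τ 1 = [s(c, d)] := rfl
  have p2 : play (promisingStrategy b c d e) τ 2 = [s(c, d), y] := by
    rw [hy]; rfl
  have hyl : LegalFrom R B [s(c, d)] y := by
    have := hτ 1 rfl ⟨s(b, d), by simp [p1, LegalFrom]; grind⟩
    rwa [p1, ← hy] at this
  obtain ⟨-, hyR, hyB, hycd⟩ := hyl
  have hlegal0 : LegalFrom R B [] s(c, d) := by simp [LegalFrom, hncd, hcd]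
  have hthreat0 : IsThreat (redAfter R [s(c, d)]) (blueAfter B [s(c, d)])
      {a, c, b, d} s(b, d) := by
    refine isThreat_of_five_edges_s6 (by grind) ?_ ?_ ?_ ?_ ?_ ?_ ?_ <;>
      simp [redAfter, blueAfter, firstPlayerEdges_cons, secondPlayerEdges_cons,
        firstPlayerEdges_nil, secondPlayerEdges_nil] <;> grind
  by_cases hybd : y = s(b, d)
  · subst hybd
    obtain ⟨z, hz⟩ : ∃ z, z = τ [s(c, d), s(b, d), s(c, e)] := ⟨_, rfl⟩
    have p3 : play (promisingStrategy b c d e) τ 3 = [s(c, d), s(b, d), s(c, e)] := by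
      rw [play, p2]; simp [promisingStrategy]
    have p4 : play (promisingStrategy b c d e) τ 4 = [s(c, d), s(b, d), s(c, e), z] := by
      rw [play, p3, hz]; rfl
    obtain ⟨w, hw⟩ : ∃ w, w = if z = s(b, e) then s(d, e) else s(b, e) := ⟨_, rfl⟩
    have p5 : play (promisingStrategy b c d e) τ 5 = [s(c, d), s(b, d), s(c, e), z, w] := by
      rw [play, p4, hw]; simp [promisingStrategy]
    have hzl : LegalFrom R B [s(c, d), s(b, d), s(c, e)] z := by
      have := hτ 3 rfl ⟨s(b, e), by simp [p3, LegalFrom]; grind⟩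
      rwa [p3, ← hz] at this
    obtain ⟨-, hzR, hzB, hzh⟩ := hzl
    have hlegal2 : LegalFrom R B [s(c, d), s(b, d)] s(c, e) := by
      simp [LegalFrom]; grind
    have hlegal4 : LegalFrom R B [s(c, d), s(b, d), s(c, e), z] w := by
      rw [hw]
      split_ifs with hzbe
      · rw [hzbe]; simp [LegalFrom]; grind
      · simp [LegalFrom]; grind
    have hthreat_be : IsThreat (redAfter R [s(c, d), s(b, d), s(c, e)])
        (blueAfter B [s(c, d), s(b, d), s(c, e)]) {a, c, b, e} s(b, e) := by
      refine isThreat_of_five_edges_s6 (by grind) ?_ ?_ ?_ ?_ ?_ ?_ ?_ <;>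
        simp [redAfter, blueAfter, firstPlayerEdges_cons, secondPlayerEdges_cons,
          firstPlayerEdges_nil, secondPlayerEdges_nil] <;> grind
    have hthreat_de : IsThreat (redAfter R [s(c, d), s(b, d), s(c, e)])
        (blueAfter B [s(c, d), s(b, d), s(c, e)]) {a, c, d, e} s(d, e) := by
      refine isThreat_of_five_edges_s6 (by grind) ?_ ?_ ?_ ?_ ?_ ?_ ?_ <;>
        simp [redAfter, blueAfter, firstPlayerEdges_cons, secondPlayerEdges_cons,
          firstPlayerEdges_nil, secondPlayerEdges_nil] <;> grind
    refine ⟨5, le_rfl, rfl, ?_, ?_, ?_, ?_⟩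
    · intro m hm hm2
      obtain rfl | rfl | rfl : m = 0 ∨ m = 2 ∨ m = 4 := by omega
      · exact hlegal0
      · rw [p2]; simpa [promisingStrategy] using hlegal2
      · rw [p4]; simpa [promisingStrategy, ← hw] using hlegal4
    · intro m hm2 hm
      obtain rfl | rfl : m = 0 ∨ m = 2 := by omega
      · exact ⟨_, _, hthreat0⟩
      · rw [p3]; exact ⟨_, _, hthreat_be⟩
    · rw [p5]
      have hK : HasK4 (insert w (redAfter R [s(c, d), s(b, d), s(c, e)])) := by
        rw [hw]
        split_ifs
        · exact hthreat_de.hasK4_insert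
        · exact hthreat_be.hasK4_insert
      refine hK.mono ?_
      simp only [redAfter, firstPlayerEdges_cons, secondPlayerEdges_cons,
        secondPlayerEdges_nil]
      grind
    · rw [p5]
      refine mt (HasK4.mono ?_) (not_hasK4_insert_of_not_hasThreat_s6 (y := z) hnoblueK4
        hnobluethreat (by simp; grind) (by simpa using hzR))
      simp only [blueAfter, firstPlayerEdges_cons, secondPlayerEdges_cons,
        firstPlayerEdges_nil]
      grind
  · have p3 : play (promisingStrategy b c d e) τ 3 = [s(c, d), y, s(b, d)] := by
      rw [play, p2]; simp [promisingStrategy, hybd]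
    have hlegal2 : LegalFrom R B [s(c, d), y] s(b, d) := by
      simp [LegalFrom]; grind
    refine ⟨3, by norm_num, rfl, ?_, ?_, ?_, ?_⟩
    · intro m hm hm2
      obtain rfl | rfl : m = 0 ∨ m = 2 := by omega
      · exact hlegal0
      · rw [p2]; simpa [promisingStrategy, hybd] using hlegal2
    · intro m hm2 hm
      obtain rfl : m = 0 := by omega
      exact ⟨_, _, hthreat0⟩
    · rw [p3]
      refine hthreat0.hasK4_insert.mono ?_
      simp only [redAfter, firstPlayerEdges_cons, secondPlayerEdges_cons,
        secondPlayerEdges_nil]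
      grind
    · rw [p3]
      refine mt (HasK4.mono ?_) (not_hasK4_insert_of_not_hasThreat_s6 (y := y) hnoblueK4
        hnobluethreat (by simp; grind) (by simpa using hyR))
      simp only [blueAfter, firstPlayerEdges_cons, secondPlayerEdges_cons,
        firstPlayerEdges_nil]
      grind
end

section
/- Flaw in Beck's case L(3): Consider a position in the K^4-building game on ten distinct vertices A, B, C, D, K, L, P1, P2, P3, P4 in which the red (first player's) edges are exactly AC, AK, AB, CB, BD, AD, AP1, DP1, AP2, AP3, AP4, LD, P1L, P3K and the blue (second player's) edges are exactly LA, CK, KB, KL, CD, CL, CP1, BP1, BP2, BP3, KD, KP1, P1P3, P1P2, with all other edges unclaimed and the first player to move. Then: (i) the blue edges admit two threats with distinct unclaimed missing edges, namely on {B, P1, P2, P3} missing P2P3 and on {K, B, P1, P2} missing KP2; (ii) there is no 4-element vertex set carrying five red edges with the sixth edge unclaimed; consequently, whatever unclaimed edge the first player claims next, she does not complete a red K^4 and the second player can then claim an unclaimed edge completing a blue K^4. Hence the second player wins from this position. -/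
/-- The red edges of the position, with `A, B, C, D, K, L, P1, P2, P3, P4` labelled `0, …, 9`. -/
def redLabels : Finset (Sym2 (Fin 10)) :=
  {s(0, 2), s(0, 4), s(0, 1), s(2, 1), s(1, 3), s(0, 3), s(0, 6), s(3, 6), s(0, 7), s(0, 8),
    s(0, 9), s(5, 3), s(6, 5), s(8, 4)}

/-- The blue edges of the position, labelled as in `redLabels`. -/
def blueLabels : Finset (Sym2 (Fin 10)) :=
  {s(5, 0), s(2, 4), s(4, 1), s(4, 5), s(2, 3), s(2, 5), s(2, 6), s(1, 6), s(1, 7), s(1, 8),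
    s(4, 3), s(4, 6), s(6, 8), s(6, 7)}

theorem disjoint_redLabels_blueLabels : Disjoint redLabels blueLabels := by decide

set_option maxRecDepth 10000 in
set_option synthInstance.maxHeartbeats 200000 in
set_option synthInstance.maxSize 1000 in
/-- The outer vertices of two red triangles on a common edge are joined in blue. -/
theorem mem_blueLabels_of_red_triangles :
    ∀ c d : Fin 10, s(c, d) ∈ redLabels →
      ∀ a : Fin 10, s(a, c) ∈ redLabels → s(a, d) ∈ redLabels →
        ∀ b : Fin 10, s(b, c) ∈ redLabels → s(b, d) ∈ redLabels →
          a ≠ b → s(a, b) ∈ blueLabels := by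
  decide

/-- A four-element set can be listed as `a, b, c, d` so that none of its pairs other than `s(a, b)`
equals `x`. -/
theorem exists_pairs_ne {t : Finset ℕ} (ht : t.card = 4) (x : Sym2 ℕ) :
    ∃ a ∈ t, ∃ b ∈ t, ∃ c ∈ t, ∃ d ∈ t, a ≠ b ∧ a ≠ c ∧ a ≠ d ∧ b ≠ c ∧ b ≠ d ∧ c ≠ d ∧
      s(c, d) ≠ x ∧ s(a, c) ≠ x ∧ s(a, d) ≠ x ∧ s(b, c) ≠ x ∧ s(b, d) ≠ x := by
  obtain ⟨p, q, r, s, hpq, hpr, hps, hqr, hqs, hrs, rfl⟩ := Finset.card_eq_four.mp ht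
  have of_eq : ∀ a b c d : ℕ, a ≠ b → a ≠ c → a ≠ d → b ≠ c → b ≠ d → c ≠ d → s(a, b) = x →
      a ≠ b ∧ a ≠ c ∧ a ≠ d ∧ b ≠ c ∧ b ≠ d ∧ c ≠ d ∧
        s(c, d) ≠ x ∧ s(a, c) ≠ x ∧ s(a, d) ≠ x ∧ s(b, c) ≠ x ∧ s(b, d) ≠ x := by
    rintro a b c d hab hac had hbc hbd hcd rfl
    simp only [ne_eq, Sym2.eq_iff]
    omega
  by_cases hx : s(r, s) = x
  · exact ⟨r, by simp, s, by simp, p, by simp, q, by simp,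
      of_eq r s p q hrs hpr.symm hqr.symm hps.symm hqs.symm hpq hx⟩
  by_cases hpr_eq : s(p, r) = x
  · exact ⟨p, by simp, r, by simp, q, by simp, s, by simp,
      of_eq p r q s hpr hpq hps hqr.symm hrs hqs hpr_eq⟩
  by_cases hps_eq : s(p, s) = x
  · exact ⟨p, by simp, s, by simp, q, by simp, r, by simp,
      of_eq p s q r hps hpq hpr hqs.symm hrs.symm hqr hps_eq⟩
  by_cases hqr_eq : s(q, r) = x
  · exact ⟨q, by simp, r, by simp, p, by simp, s, by simp,
      of_eq q r p s hqr hpq.symm hqs hpr.symm hrs hps hqr_eq⟩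
  by_cases hqs_eq : s(q, s) = x
  · exact ⟨q, by simp, s, by simp, p, by simp, r, by simp,
      of_eq q s p r hqs hpq.symm hqr hps.symm hrs.symm hpr hqs_eq⟩
  exact ⟨p, by simp, q, by simp, r, by simp, s, by simp,
    hpq, hpr, hps, hqr, hqs, hrs, hx, hpr_eq, hps_eq, hqr_eq, hqs_eq⟩

/-- A pair of labels lies in `E` as soon as its image lies in the image of `E`. -/
theorem mem_of_mem_image_map {v : Fin 10 → ℕ} (hv : Function.Injective v)
    {E : Finset (Sym2 (Fin 10))} {i j : Fin 10} (h : s(v i, v j) ∈ E.image (Sym2.map v)) :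
    s(i, j) ∈ E := by
  obtain ⟨e, he, h⟩ := Finset.mem_image.mp h
  rw [← Sym2.map_mk] at h
  exact Sym2.map.injective hv h ▸ he

/-- The vertices of a pair in the image of `E` are images of labels. -/
theorem exists_labels_of_mem_image_map {v : Fin 10 → ℕ} {E : Finset (Sym2 (Fin 10))} {a b : ℕ}
    (h : s(a, b) ∈ E.image (Sym2.map v)) : ∃ i j, v i = a ∧ v j = b := by
  obtain ⟨e, -, h⟩ := Finset.mem_image.mp h
  induction e with
  | h i j =>
    rw [Sym2.map_mk, Sym2.eq_iff] at h
    rcases h with h | h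
    exacts [⟨i, j, h⟩, ⟨j, i, h.symm⟩]

/-- No unclaimed edge `x` is the only one missing from a red `K^4`, and there is no red `K^4`. -/
theorem not_red_off_edge {v : Fin 10 → ℕ} (hv : Function.Injective v) {t : Finset ℕ}
    (ht : t.card = 4) {x : Sym2 ℕ} (hx : x ∉ blueLabels.image (Sym2.map v)) :
    ¬ ∀ u ∈ t, ∀ w ∈ t, u ≠ w → s(u, w) ≠ x → s(u, w) ∈ redLabels.image (Sym2.map v) := by
  intro h
  obtain ⟨a, ha, b, hb, c, hc, d, hd, hab, hac, had, hbc, hbd, hcd, xcd, xac, xad, xbc, xbd⟩ :=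
    exists_pairs_ne ht x
  have rcd := h c hc d hd hcd xcd
  have rac := h a ha c hc hac xac
  have rad := h a ha d hd had xad
  have rbc := h b hb c hc hbc xbc
  have rbd := h b hb d hd hbd xbd
  have hred := h a ha b hb hab
  obtain ⟨k, l, rfl, rfl⟩ := exists_labels_of_mem_image_map rcd
  obtain ⟨i, -, rfl, -⟩ := exists_labels_of_mem_image_map rac
  obtain ⟨j, -, rfl, -⟩ := exists_labels_of_mem_image_map rbc
  have hblue := mem_blueLabels_of_red_triangles k l (mem_of_mem_image_map hv rcd)
    i (mem_of_mem_image_map hv rac) (mem_of_mem_image_map hv rad)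
    j (mem_of_mem_image_map hv rbc) (mem_of_mem_image_map hv rbd) (fun e => hab (e ▸ rfl))
  have hmem := Finset.mem_image_of_mem (Sym2.map v) hblue
  rw [Sym2.map_mk] at hmem
  exact Finset.disjoint_left.mp disjoint_redLabels_blueLabels
    (mem_of_mem_image_map hv (hred fun e => hx (e ▸ hmem))) hblue

/-- Claiming the missing edge of a threat completes a `K^4`. -/
theorem IsThreat.hasK4 {C O : Set (Sym2 ℕ)} {t : Finset ℕ} {x : Sym2 ℕ} (h : IsThreat C O t x) :
    HasK4 (C ∪ {x}) := by
  refine ⟨t, h.1, fun u hu w hw huw => ?_⟩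
  by_cases hx : s(u, w) = x
  · exact Or.inr hx
  · exact Or.inl (h.2.2.2.2 u hu w hw huw hx)

/-- The missing edge of a threat is a proper edge. -/
theorem IsThreat.not_isDiag {C O : Set (Sym2 ℕ)} {t : Finset ℕ} {x : Sym2 ℕ}
    (h : IsThreat C O t x) : ¬ x.IsDiag := by
  obtain ⟨u, -, w, -, huw, rfl⟩ := h.2.1
  simpa using huw


/-- The flaw in Beck's case L(3): in the displayed position (arising when the
first player follows the strategy of case L(3)), with the first player to
move, (i) the blue edges admit two threats with distinct unclaimed missing
edges, on `{B, P1, P2, P3}` missing `P2P3` and on `{K, B, P1, P2}` missing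
`KP2`; (ii) there is no 4-element vertex set carrying five red edges with the
sixth edge unclaimed; consequently (iii) whatever unclaimed edge the first
player claims next, she does not complete a red `K^4` and the second player
can then claim an unclaimed edge completing a blue `K^4`.  Hence the second
player wins from this position. -/
theorem beck_case_L3_flaw
    (vA vB vC vD vK vL vP1 vP2 vP3 vP4 : ℕ)
    (hdist : ([vA, vB, vC, vD, vK, vL, vP1, vP2, vP3, vP4] : List ℕ).Nodup)
    (R Bl : Finset (Sym2 ℕ))
    (hR : R = {s(vA, vC), s(vA, vK), s(vA, vB), s(vC, vB), s(vB, vD),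
      s(vA, vD), s(vA, vP1), s(vD, vP1), s(vA, vP2), s(vA, vP3), s(vA, vP4),
      s(vL, vD), s(vP1, vL), s(vP3, vK)})
    (hBl : Bl = {s(vL, vA), s(vC, vK), s(vK, vB), s(vK, vL), s(vC, vD),
      s(vC, vL), s(vC, vP1), s(vB, vP1), s(vB, vP2), s(vB, vP3), s(vK, vD),
      s(vK, vP1), s(vP1, vP3), s(vP1, vP2)}) :
    (IsThreat ↑Bl ↑R {vB, vP1, vP2, vP3} s(vP2, vP3) ∧
      IsThreat ↑Bl ↑R {vK, vB, vP1, vP2} s(vK, vP2) ∧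
      s(vP2, vP3) ≠ s(vK, vP2)) ∧
    ¬ HasThreat ↑R ↑Bl ∧
    (∀ x : Sym2 ℕ, ¬ x.IsDiag → x ∉ R → x ∉ Bl →
      ¬ HasK4 (↑R ∪ {x}) ∧
      ∃ y : Sym2 ℕ, ¬ y.IsDiag ∧ y ∉ R ∧ y ∉ Bl ∧ y ≠ x ∧
        HasK4 (↑Bl ∪ {y})) := by
  have hv : Function.Injective ![vA, vB, vC, vD, vK, vL, vP1, vP2, vP3, vP4] := by
    rw [← List.nodup_ofFn]
    simpa [List.ofFn_succ] using hdist
  have hR' : R = redLabels.image (Sym2.map ![vA, vB, vC, vD, vK, vL, vP1, vP2, vP3, vP4]) := by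
    simp [hR, redLabels, Finset.image_insert]
  have hBl' : Bl = blueLabels.image (Sym2.map ![vA, vB, vC, vD, vK, vL, vP1, vP2, vP3, vP4]) := by
    simp [hBl, blueLabels, Finset.image_insert]
  have threat₁ : IsThreat ↑Bl ↑R {vB, vP1, vP2, vP3} s(vP2, vP3) := by
    simp only [List.nodup_cons, List.mem_cons, List.not_mem_nil, or_false, not_or] at hdist
    refine ⟨Finset.card_eq_four.mpr ⟨vB, vP1, vP2, vP3, by grind⟩,
      ⟨vP2, by simp, vP3, by simp, by grind, rfl⟩, ?_, ?_, ?_⟩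
    · simp only [hBl, Finset.mem_coe, Finset.mem_insert, Finset.mem_singleton, Sym2.eq_iff]
      grind
    · simp only [hR, Finset.mem_coe, Finset.mem_insert, Finset.mem_singleton, Sym2.eq_iff]
      grind
    · simp [hBl, hdist]
  have threat₂ : IsThreat ↑Bl ↑R {vK, vB, vP1, vP2} s(vK, vP2) := by
    simp only [List.nodup_cons, List.mem_cons, List.not_mem_nil, or_false, not_or] at hdist
    refine ⟨Finset.card_eq_four.mpr ⟨vK, vB, vP1, vP2, by grind⟩,
      ⟨vK, by simp, vP2, by simp, by grind, rfl⟩, ?_, ?_, ?_⟩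
    · simp only [hBl, Finset.mem_coe, Finset.mem_insert, Finset.mem_singleton, Sym2.eq_iff]
      grind
    · simp only [hR, Finset.mem_coe, Finset.mem_insert, Finset.mem_singleton, Sym2.eq_iff]
      grind
    · simp [hBl, hdist]
  have hne : s(vP2, vP3) ≠ s(vK, vP2) := by
    simp only [List.nodup_cons, List.mem_cons, List.not_mem_nil, or_false, not_or] at hdist
    simp only [ne_eq, Sym2.eq_iff]
    grind
  refine ⟨⟨threat₁, threat₂, hne⟩, ?_, fun x _ _ hxB => ⟨?_, ?_⟩⟩
  · rintro ⟨t, x, ht, -, -, hxB, h⟩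
    subst hR' hBl'
    exact not_red_off_edge hv ht hxB h
  · rintro ⟨t, ht, h⟩
    subst hR' hBl'
    exact not_red_off_edge hv ht hxB fun u hu w hw huw hne =>
      (h u hu w hw huw).resolve_right hne
  · by_cases hx : s(vP2, vP3) = x
    · exact ⟨s(vK, vP2), threat₂.not_isDiag, threat₂.2.2.2.1, threat₂.2.2.1,
        fun e => hne (hx.trans e.symm), threat₂.hasK4⟩
    · exact ⟨s(vP2, vP3), threat₁.not_isDiag, threat₁.2.2.2.1, threat₁.2.2.1, hx,
        threat₁.hasK4⟩
end
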